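/- For every integer a ≥ 3, every type-1 configuration of [a,1,1] admits a proper 4-coloring. -/

import Mathlib

/-- A cuboid with integer root and integer dimensions. -/
structure Cuboid where
  root : ℤ × ℤ × ℤ
  dims : ℤ × ℤ × ℤ
deriving DecidableEq

namespace Cuboid

/-- The dimensions are positive. -/
def valid (C : Cuboid) : Prop :=
  0 < C.dims.1 ∧ 0 < C.dims.2.1 ∧ 0 < C.dims.2.2

/-- The closed cuboid `[x,x+a] × [y,y+b] × [z,z+c] ⊆ ℝ³`. -/
def toSet (C : Cuboid) : Set (ℝ × ℝ × ℝ) :=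
  {p | (C.root.1 : ℝ) ≤ p.1 ∧ p.1 ≤ C.root.1 + C.dims.1 ∧
       (C.root.2.1 : ℝ) ≤ p.2.1 ∧ p.2.1 ≤ C.root.2.1 + C.dims.2.1 ∧
       (C.root.2.2 : ℝ) ≤ p.2.2 ∧ p.2.2 ≤ C.root.2.2 + C.dims.2.2}

/-- The open cuboid `(x,x+a) × (y,y+b) × (z,z+c) ⊆ ℝ³` (the interior). -/
def inte (C : Cuboid) : Set (ℝ × ℝ × ℝ) :=
  {p | (C.root.1 : ℝ) < p.1 ∧ p.1 < C.root.1 + C.dims.1 ∧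
       (C.root.2.1 : ℝ) < p.2.1 ∧ p.2.1 < C.root.2.1 + C.dims.2.1 ∧
       (C.root.2.2 : ℝ) < p.2.2 ∧ p.2.2 < C.root.2.2 + C.dims.2.2}

/-- The set `(ℤ×ℤ×ℝ) ∪ (ℤ×ℝ×ℤ) ∪ (ℝ×ℤ×ℤ)` of grid lines. -/
def grid : Set (ℝ × ℝ × ℝ) :=
  {p | ((∃ m : ℤ, p.1 = m) ∧ (∃ n : ℤ, p.2.1 = n)) ∨
       ((∃ m : ℤ, p.1 = m) ∧ (∃ n : ℤ, p.2.2 = n)) ∨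
       ((∃ m : ℤ, p.2.1 = m) ∧ (∃ n : ℤ, p.2.2 = n))}

/-- Two cuboids collide when their interiors intersect. -/
def Collide (C D : Cuboid) : Prop := (C.inte ∩ D.inte).Nonempty

/-- Two cuboids touch when their interiors are disjoint but their intersection
contains a point outside the grid lines (i.e. it is a non-degenerate rectangle). -/
def Touch (C D : Cuboid) : Prop :=
  ¬ Collide C D ∧ ∃ p ∈ C.toSet ∩ D.toSet, p ∉ grid

end Cuboid

/-- A configuration: a finite family of valid pairwise non-colliding cuboids. -/
def IsConfig (F : Finset Cuboid) : Prop :=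
  (∀ C ∈ F, C.valid) ∧ ∀ C ∈ F, ∀ D ∈ F, C ≠ D → ¬ Cuboid.Collide C D

/-- A type-1 configuration of `[a,b,c]`: every cuboid has dimensions exactly `(a,b,c)`. -/
def Type1 (a b c : ℕ) (F : Finset Cuboid) : Prop :=
  ∀ C ∈ F, C.dims = ((a : ℤ), (b : ℤ), (c : ℤ))

/-- A type-2 configuration of `[a,b,c]`: every cuboid has dimensions `(a,b,c)` or `(b,a,c)`. -/
def Type2 (a b c : ℕ) (F : Finset Cuboid) : Prop :=
  ∀ C ∈ F, C.dims = ((a : ℤ), (b : ℤ), (c : ℤ)) ∨ C.dims = ((b : ℤ), (a : ℤ), (c : ℤ))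

/-- A type-3 configuration of `[a,b,c]`: every cuboid's dimensions are a permutation of `(a,b,c)`. -/
def Type3 (a b c : ℕ) (F : Finset Cuboid) : Prop :=
  ∀ C ∈ F, C.dims = ((a : ℤ), (b : ℤ), (c : ℤ)) ∨ C.dims = ((a : ℤ), (c : ℤ), (b : ℤ)) ∨
    C.dims = ((b : ℤ), (a : ℤ), (c : ℤ)) ∨ C.dims = ((b : ℤ), (c : ℤ), (a : ℤ)) ∨
    C.dims = ((c : ℤ), (a : ℤ), (b : ℤ)) ∨ C.dims = ((c : ℤ), (b : ℤ), (a : ℤ))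

/-- A proper `k`-coloring of a configuration: touching cuboids get distinct colors. -/
def ProperColoring (k : ℕ) (F : Finset Cuboid) : Prop :=
  ∃ κ : Cuboid → Fin k, ∀ C ∈ F, ∀ D ∈ F, Cuboid.Touch C D → κ C ≠ κ D

namespace Cuboid

/-- Integer intervals `[m, m + l]` and `[n, n + l]` with a common real point: either they overlap
in positive length, or they abut at that point, which is then an integer. -/
lemma abs_sub_lt_or_abut {m n l : ℤ} {t : ℝ} (hm : (m : ℝ) ≤ t) (hm' : t ≤ m + l)
    (hn : (n : ℝ) ≤ t) (hn' : t ≤ n + l) :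
    (n - m < l ∧ m - n < l) ∨ ((n = m + l ∨ m = n + l) ∧ ∃ k : ℤ, t = k) := by
  have h1 : n ≤ m + l := by exact_mod_cast hn.trans hm'
  have h2 : m ≤ n + l := by exact_mod_cast hm.trans hn'
  rcases h1.eq_or_lt with h | h
  · exact .inr ⟨.inl h, n, le_antisymm (by rw [h]; exact_mod_cast hm') hn⟩
  rcases h2.eq_or_lt with h' | h'
  · exact .inr ⟨.inr h', m, le_antisymm (by rw [h']; exact_mod_cast hn') hm⟩
  · exact .inl ⟨by lia, by lia⟩

/-- Touching translates of an `a × 1 × 1` cuboid either abut within a common row parallel to the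
first axis, or lie in adjacent rows. -/
lemma Touch.same_row_or_adjacent {a : ℤ} {C D : Cuboid} (hC : C.dims = (a, 1, 1))
    (hD : D.dims = (a, 1, 1)) (h : Touch C D) :
    (C.root.2 = D.root.2 ∧ (D.root.1 = C.root.1 + a ∨ C.root.1 = D.root.1 + a)) ∨
      (C.root.2.1 + C.root.2.2 = D.root.2.1 + D.root.2.2 + 1 ∨
        D.root.2.1 + D.root.2.2 = C.root.2.1 + C.root.2.2 + 1) := by
  obtain ⟨⟨x, y, z⟩, d⟩ := C
  obtain ⟨⟨x', y', z'⟩, d'⟩ := D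
  obtain rfl : d = (a, 1, 1) := hC
  obtain rfl : d' = (a, 1, 1) := hD
  obtain ⟨hcol, ⟨p, q, r⟩, ⟨⟨c1, c2, c3, c4, c5, c6⟩, d1, d2, d3, d4, d5, d6⟩, hgrid⟩ := h
  simp only [grid, Set.mem_ofPred_eq, not_or, not_and] at hgrid
  obtain ⟨g1, g2, g3⟩ := hgrid
  dsimp only at *
  simp only [Prod.mk.injEq]
  rcases abs_sub_lt_or_abut c1 c2 d1 d2 with hx | ⟨hx, kx⟩ <;>
  rcases abs_sub_lt_or_abut c3 c4 d3 d4 with hy | ⟨hy, ky⟩ <;>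
  rcases abs_sub_lt_or_abut c5 c6 d5 d6 with hz | ⟨hz, kz⟩
  · obtain rfl : y = y' := by lia
    obtain rfl : z = z' := by lia
    have e1 : (x' : ℝ) < x + a := by exact_mod_cast (by lia : x' < x + a)
    have e2 : (x : ℝ) < x' + a := by exact_mod_cast (by lia : x < x' + a)
    refine absurd ⟨((x + x' + a) / 2, y + 1 / 2, z + 1 / 2), ?_, ?_⟩ hcol <;>
      simp only [inte, Set.mem_ofPred_eq] <;> push_cast <;>
      refine ⟨?_, ?_, ?_, ?_, ?_, ?_⟩ <;> linarith
  all_goals first | exact absurd kz (g3 ky) | exact absurd kz (g2 kx) | exact absurd ky (g1 kx) | lia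

/-- The color of a cuboid of length `a`: the parity of its row, together with the parity of its
position along the row in units of `a`. -/
def rowColor (a : ℤ) (C : Cuboid) : Fin 4 :=
  ⟨(2 * ((C.root.2.1 + C.root.2.2) % 2) + C.root.1 / a % 2).toNat, by lia⟩

lemma Touch.rowColor_ne {a : ℤ} (ha : a ≠ 0) {C D : Cuboid} (hC : C.dims = (a, 1, 1))
    (hD : D.dims = (a, 1, 1)) (h : Touch C D) : rowColor a C ≠ rowColor a D := by
  have shift (n : ℤ) : (n + a) / a = n / a + 1 := by
    rw [Int.add_ediv_of_dvd_right dvd_rfl, Int.ediv_self ha]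
  simp only [rowColor, ne_eq, Fin.mk.injEq]
  rcases h.same_row_or_adjacent hC hD with ⟨hr, hx | hx⟩ | hr
  · rw [hx, hr, shift]
    lia
  · rw [hx, hr, shift]
    lia
  · lia

end Cuboid

/-- For `a ≥ 3`, every type-1 configuration of `[a,1,1]` admits a proper 4-coloring. -/
theorem type1_a11_4colorable (a : ℕ) (ha : 3 ≤ a) :
    ∀ F : Finset Cuboid, IsConfig F → Type1 a 1 1 F → ProperColoring 4 F := by
  intro F _ hF
  refine ⟨Cuboid.rowColor a, fun C hC D hD h => h.rowColor_ne (by lia) ?_ ?_⟩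
  · exact_mod_cast hF C hC
  · exact_mod_cast hF D hD
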